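/- Let φ : ℝ → ℝ be a C^∞ function with φ''(1) = 0. Let k₁, k₂, h₁, h₂ be real numbers, Ω ⊆ ℝ² open with (0,0) ∈ Ω, T > 0, and let u ∈ C²(Ω×[0,T)) satisfy u_t = div(φ'(|∇u|)·∇u/|∇u|) at every point where ∇u ≠ 0, with initial datum u(x,y,0) = u₀(x,y) where u₀ is of class C³ and u₀(x,y) = (√2/2)x + (√2/2)y + k₁x² + k₂y² + h₁x³ + h₂y³ + o((x²+y²)^{3/2}) as (x,y) → (0,0). Then the partial derivative ∂/∂t of |∇u|² at the point (0,0,0) exists and equals φ'(1)·(3√2·(h₁+h₂) + 4k₁k₂ − 6k₁² − 6k₂²) + 2φ'''(1)·(k₁+k₂)². -/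

import Mathlib

open Asymptotics Filter Topology

/-- squared norm of the spatial gradient of `u = u(x,y,t)` -/
noncomputable def gradSqT (u : ℝ → ℝ → ℝ → ℝ) (x y t : ℝ) : ℝ :=
  (deriv (fun s => u s y t) x) ^ 2 + (deriv (fun s => u x s t) y) ^ 2

/-- first component of the Perona–Malik flux `φ'(|∇u|)·∇u/|∇u|` -/
noncomputable def pmFlux1 (φ : ℝ → ℝ) (u : ℝ → ℝ → ℝ → ℝ) (x y t : ℝ) : ℝ :=
  deriv φ (Real.sqrt (gradSqT u x y t)) * (deriv (fun s => u s y t) x) /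
    Real.sqrt (gradSqT u x y t)

/-- second component of the Perona–Malik flux `φ'(|∇u|)·∇u/|∇u|` -/
noncomputable def pmFlux2 (φ : ℝ → ℝ) (u : ℝ → ℝ → ℝ → ℝ) (x y t : ℝ) : ℝ :=
  deriv φ (Real.sqrt (gradSqT u x y t)) * (deriv (fun s => u x s t) y) /
    Real.sqrt (gradSqT u x y t)

/-- A cubic polynomial that is `o(t³)` at `0` vanishes identically. -/
theorem cubic_coeff_eq_zero_of_isLittleO {a₀ a₁ a₂ a₃ : ℝ}
    (h : (fun t : ℝ => a₀ + a₁ * t + a₂ * t ^ 2 + a₃ * t ^ 3) =o[𝓝 0] fun t : ℝ => t ^ 3) :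
    a₀ = 0 ∧ a₁ = 0 ∧ a₂ = 0 ∧ a₃ = 0 := by
  have key : ∀ (n : ℕ) (a : ℝ), (fun t : ℝ => a * t ^ n) =o[𝓝 0] (fun t : ℝ => t ^ n) → a = 0 := by
    intro n a ha
    by_contra hne
    have h1 : (fun t : ℝ => t ^ n) =o[𝓝 0] (fun t : ℝ => t ^ n) :=
      (isLittleO_const_mul_left_iff hne).1 ha
    refine isLittleO_irrefl ?_ (h1.mono (nhdsWithin_le_nhds (s := {0}ᶜ)))
    refine Eventually.frequently ?_
    filter_upwards [self_mem_nhdsWithin] with t ht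
    exact pow_ne_zero _ ht
  have pw : ∀ (a : ℝ) {m n : ℕ}, m < n → (fun t : ℝ => a * t ^ n) =o[𝓝 0] (fun t : ℝ => t ^ m) :=
    fun a m n hmn => (isLittleO_pow_pow hmn).const_mul_left a
  have low : ∀ {m : ℕ}, m < 3 → (fun t : ℝ => a₀ + a₁ * t + a₂ * t ^ 2 + a₃ * t ^ 3)
      =o[𝓝 0] fun t : ℝ => t ^ m := fun hm => h.trans (isLittleO_pow_pow hm)
  have h0 : a₀ = 0 := by
    refine key 0 a₀ ((((low (by norm_num : 0 < 3)).sub (pw a₁ (by norm_num : 0 < 1))).sub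
      (pw a₂ (by norm_num : 0 < 2))).sub (pw a₃ (by norm_num : 0 < 3)) |>.congr_left ?_)
    intro t; ring
  subst h0
  have h1 : a₁ = 0 := by
    refine key 1 a₁ (((low (by norm_num : 1 < 3)).sub
      (pw a₂ (by norm_num : 1 < 2))).sub (pw a₃ (by norm_num : 1 < 3)) |>.congr_left ?_)
    intro t; ring
  subst h1
  have h2 : a₂ = 0 := by
    refine key 2 a₂ ((low (by norm_num : 2 < 3)).sub (pw a₃ (by norm_num : 2 < 3))
      |>.congr_left ?_)
    intro t; ring
  subst h2
  exact ⟨rfl, rfl, rfl, key 3 a₃ (h.congr_left fun t => by ring)⟩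

/-- Integrating a little-o estimate at `0`. -/
theorem isLittleO_pow_succ_of_hasDerivAt {f f' : ℝ → ℝ} {n : ℕ}
    (hf : ∀ᶠ t in 𝓝 0, HasDerivAt f (f' t) t) (h0 : f 0 = 0)
    (h : f' =o[𝓝 0] fun t : ℝ => t ^ n) : f =o[𝓝 0] fun t : ℝ => t ^ (n + 1) := by
  obtain ⟨ε, hε, hball⟩ := Metric.eventually_nhds_iff_ball.1 hf
  have hmem : (0 : ℝ) ∈ Metric.ball (0 : ℝ) ε := Metric.mem_ball_self hε
  have := (convex_ball (0 : ℝ) ε).isLittleO_pow_succ_real (f := f) (f' := f') (n := n) hmem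
    (fun t ht => (hball t ht).hasDerivWithinAt)
    (by simpa [Metric.isOpen_ball.nhdsWithin_eq hmem] using h)
  simpa [Metric.isOpen_ball.nhdsWithin_eq hmem, h0] using this

/-- The coefficients of a third-order expansion of a thrice differentiable function at `0`. -/
theorem taylor_coeff_of_isLittleO_cubic {r r₁ r₂ : ℝ → ℝ} {c α β γ : ℝ}
    (hr : ∀ᶠ t in 𝓝 0, HasDerivAt r (r₁ t) t) (hr₁ : ∀ᶠ t in 𝓝 0, HasDerivAt r₁ (r₂ t) t)
    (hr₂ : HasDerivAt r₂ c 0)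
    (h : (fun t => r t - (α * t + β * t ^ 2 + γ * t ^ 3)) =o[𝓝 0] fun t : ℝ => t ^ 3) :
    r₁ 0 = α ∧ r₂ 0 = 2 * β ∧ c = 6 * γ := by
  have e2 : (fun t => r₂ t - (r₂ 0 + c * t)) =o[𝓝 0] fun t : ℝ => t ^ 1 := by
    have := hr₂.isLittleO
    simp only [sub_zero, smul_eq_mul] at this
    simpa [sub_sub, mul_comm c] using this
  have e1 : (fun t => r₁ t - (r₁ 0 + r₂ 0 * t + c / 2 * t ^ 2)) =o[𝓝 0] fun t : ℝ => t ^ 2 := by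
    refine isLittleO_pow_succ_of_hasDerivAt ?_ (by simp) e2
    filter_upwards [hr₁] with t ht
    have hp := ((((hasDerivAt_id t).const_mul (r₂ 0)).const_add (r₁ 0)).add
      ((hasDerivAt_pow 2 t).const_mul (c / 2)))
    refine (ht.sub hp).congr_deriv ?_
    simp; ring
  have e0 : (fun t => r t - (r 0 + r₁ 0 * t + r₂ 0 / 2 * t ^ 2 + c / 6 * t ^ 3))
      =o[𝓝 0] fun t : ℝ => t ^ 3 := by
    refine isLittleO_pow_succ_of_hasDerivAt ?_ (by simp) e1
    filter_upwards [hr] with t ht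
    have hp := (((((hasDerivAt_id t).const_mul (r₁ 0)).const_add (r 0)).add
      ((hasDerivAt_pow 2 t).const_mul (r₂ 0 / 2)))).add ((hasDerivAt_pow 3 t).const_mul (c / 6))
    refine (ht.sub hp).congr_deriv ?_
    simp; ring
  have hpoly : (fun t : ℝ => r 0 + (r₁ 0 - α) * t + (r₂ 0 / 2 - β) * t ^ 2 +
      (c / 6 - γ) * t ^ 3) =o[𝓝 0] fun t : ℝ => t ^ 3 :=
    (h.sub e0).congr_left fun t => by ring
  obtain ⟨-, h1, h2, h3⟩ := cubic_coeff_eq_zero_of_isLittleO hpoly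
  refine ⟨?_, ?_, ?_⟩ <;> linarith

/-- The function `p ↦ Df(p) v`, the derivative of `f` in the direction `v`. -/
noncomputable def dirFDeriv (v : ℝ × ℝ) (f : ℝ × ℝ → ℝ) (p : ℝ × ℝ) : ℝ := fderiv ℝ f p v

theorem ContDiffOn.dirFDeriv {f : ℝ × ℝ → ℝ} {Ω : Set (ℝ × ℝ)} {m n : WithTop ℕ∞}
    (hf : ContDiffOn ℝ n f Ω) (hΩ : IsOpen Ω) (hmn : m + 1 ≤ n) (v : ℝ × ℝ) :
    ContDiffOn ℝ m (dirFDeriv v f) Ω :=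
  (hf.fderiv_of_isOpen hΩ hmn).clm_apply contDiffOn_const

theorem ContDiffAt.dirFDeriv_comm {f : ℝ × ℝ → ℝ} {p : ℝ × ℝ}
    (hf : ContDiffAt ℝ 2 f p) (v w : ℝ × ℝ) :
    dirFDeriv v (dirFDeriv w f) p = dirFDeriv w (dirFDeriv v f) p := by
  have hd : DifferentiableAt ℝ (fderiv ℝ f) p :=
    (hf.fderiv_right (m := 1) (by norm_num)).differentiableAt one_ne_zero
  have key : ∀ a b : ℝ × ℝ, dirFDeriv a (dirFDeriv b f) p = fderiv ℝ (fderiv ℝ f) p a b := by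
    intro a b
    have := (hd.hasFDerivAt.clm_apply (hasFDerivAt_const b p)).fderiv
    change fderiv ℝ (fun q => fderiv ℝ f q b) p a = _
    rw [this]
    simp
  rw [key, key]
  exact hf.isSymmSndFDerivAt (by simp) v w

theorem Filter.EventuallyEq.dirFDeriv_eq {f g : ℝ × ℝ → ℝ} {p : ℝ × ℝ} (h : f =ᶠ[𝓝 p] g)
    (v : ℝ × ℝ) : dirFDeriv v f p = dirFDeriv v g p := by
  simp only [dirFDeriv, h.fderiv_eq]

theorem dirFDeriv_eq_add (f : ℝ × ℝ → ℝ) (p : ℝ × ℝ) (a b : ℝ) :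
    dirFDeriv (a, b) f p = a * dirFDeriv (1, 0) f p + b * dirFDeriv (0, 1) f p := by
  have : ((a, b) : ℝ × ℝ) = a • ((1 : ℝ), (0 : ℝ)) + b • ((0 : ℝ), (1 : ℝ)) := by simp
  simp only [dirFDeriv]
  rw [this, map_add, map_smul, map_smul, smul_eq_mul, smul_eq_mul]

/-- Derivative of a function along a curve with velocity `(a, b)`. -/
theorem DifferentiableAt.hasDerivAt_curve {f : ℝ × ℝ → ℝ} {x y : ℝ → ℝ} {a b t : ℝ}
    (hf : DifferentiableAt ℝ f (x t, y t)) (hx : HasDerivAt x a t) (hy : HasDerivAt y b t) :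
    HasDerivAt (fun s => f (x s, y s))
      (a * dirFDeriv (1, 0) f (x t, y t) + b * dirFDeriv (0, 1) f (x t, y t)) t := by
  rw [← dirFDeriv_eq_add]
  exact hf.hasFDerivAt.comp_hasDerivAt t (hx.prodMk hy)

/-- Derivatives at the origin, up to order three and along the line spanned by `(a, b)`, of a
function with a given third-order expansion. -/
theorem line_derivs_of_taylor {f : ℝ × ℝ → ℝ} {Ω : Set (ℝ × ℝ)} (hΩ : IsOpen Ω)
    (h0 : ((0 : ℝ), (0 : ℝ)) ∈ Ω) (hf : ContDiffOn ℝ 3 f Ω) {c k₁ k₂ h₁ h₂ : ℝ}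
    (ht : (fun p : ℝ × ℝ => f p - (c * p.1 + c * p.2 + k₁ * p.1 ^ 2 + k₂ * p.2 ^ 2 +
          h₁ * p.1 ^ 3 + h₂ * p.2 ^ 3)) =o[𝓝 ((0 : ℝ), (0 : ℝ))]
        fun p : ℝ × ℝ => (p.1 ^ 2 + p.2 ^ 2) ^ ((3 : ℝ) / 2)) (a b : ℝ) :
    (a * dirFDeriv (1, 0) f (0, 0) + b * dirFDeriv (0, 1) f (0, 0) = c * a + c * b) ∧
    (a * (a * dirFDeriv (1, 0) (dirFDeriv (1, 0) f) (0, 0)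
        + b * dirFDeriv (0, 1) (dirFDeriv (1, 0) f) (0, 0))
      + b * (a * dirFDeriv (1, 0) (dirFDeriv (0, 1) f) (0, 0)
        + b * dirFDeriv (0, 1) (dirFDeriv (0, 1) f) (0, 0)) =
      2 * (k₁ * a ^ 2 + k₂ * b ^ 2)) ∧
    (a * (a * (a * dirFDeriv (1, 0) (dirFDeriv (1, 0) (dirFDeriv (1, 0) f)) (0, 0)
          + b * dirFDeriv (0, 1) (dirFDeriv (1, 0) (dirFDeriv (1, 0) f)) (0, 0))
        + b * (a * dirFDeriv (1, 0) (dirFDeriv (0, 1) (dirFDeriv (1, 0) f)) (0, 0)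
          + b * dirFDeriv (0, 1) (dirFDeriv (0, 1) (dirFDeriv (1, 0) f)) (0, 0)))
      + b * (a * (a * dirFDeriv (1, 0) (dirFDeriv (1, 0) (dirFDeriv (0, 1) f)) (0, 0)
          + b * dirFDeriv (0, 1) (dirFDeriv (1, 0) (dirFDeriv (0, 1) f)) (0, 0))
        + b * (a * dirFDeriv (1, 0) (dirFDeriv (0, 1) (dirFDeriv (0, 1) f)) (0, 0)
          + b * dirFDeriv (0, 1) (dirFDeriv (0, 1) (dirFDeriv (0, 1) f)) (0, 0))) =
      6 * (h₁ * a ^ 3 + h₂ * b ^ 3)) := by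
  have hg : ∀ v, ContDiffOn ℝ 2 (dirFDeriv v f) Ω := hf.dirFDeriv hΩ (by norm_num)
  have hh : ∀ v w, ContDiffOn ℝ 1 (dirFDeriv w (dirFDeriv v f)) Ω := fun v =>
    (hg v).dirFDeriv hΩ (by norm_num)
  have cur : ∀ {g : ℝ × ℝ → ℝ} {t : ℝ}, DifferentiableOn ℝ g Ω → (t * a, t * b) ∈ Ω →
      HasDerivAt (fun s => g (s * a, s * b)) (a * dirFDeriv (1, 0) g (t * a, t * b) +
        b * dirFDeriv (0, 1) g (t * a, t * b)) t := fun {g t} hg hm =>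
    (hg.differentiableAt (hΩ.mem_nhds hm)).hasDerivAt_curve (x := fun s => s * a)
      (y := fun s => s * b) (by simpa using (hasDerivAt_id t).mul_const a)
      (by simpa using (hasDerivAt_id t).mul_const b)
  have htend : Tendsto (fun t : ℝ => (t * a, t * b)) (𝓝 0) (𝓝 ((0 : ℝ), (0 : ℝ))) := by
    have : Continuous fun t : ℝ => (t * a, t * b) := by fun_prop
    simpa using this.tendsto 0
  have hev : ∀ᶠ t : ℝ in 𝓝 0, (t * a, t * b) ∈ Ω := htend.eventually (hΩ.mem_nhds h0)
  have h0' : ((0 : ℝ) * a, (0 : ℝ) * b) ∈ Ω := by simpa using h0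
  have hbig : (fun t : ℝ => ((t * a) ^ 2 + (t * b) ^ 2) ^ ((3 : ℝ) / 2))
      =O[𝓝 0] fun t : ℝ => t ^ 3 := by
    refine IsBigO.of_bound ((a ^ 2 + b ^ 2) ^ ((3 : ℝ) / 2)) (Eventually.of_forall fun t => ?_)
    have h1 : (t * a) ^ 2 + (t * b) ^ 2 = (a ^ 2 + b ^ 2) * |t| ^ 2 := by rw [sq_abs]; ring
    have h2 : (|t| ^ 2) ^ ((3 : ℝ) / 2) = |t| ^ 3 := by
      rw [← Real.rpow_natCast, ← Real.rpow_mul (abs_nonneg t), ← Real.rpow_natCast]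
      norm_num
    rw [h1, Real.mul_rpow (by positivity) (by positivity), h2, Real.norm_eq_abs,
      Real.norm_eq_abs, abs_pow, abs_of_nonneg (by positivity)]
  have key := taylor_coeff_of_isLittleO_cubic
    (hev.mono fun t hm => cur (hf.differentiableOn (by norm_num)) hm)
    (hev.mono fun t hm =>
      ((cur ((hg (1, 0)).differentiableOn (by norm_num)) hm).const_mul a).add
      ((cur ((hg (0, 1)).differentiableOn (by norm_num)) hm).const_mul b))
    ((((cur ((hh (1, 0) (1, 0)).differentiableOn (by norm_num)) h0').const_mul a).add
      ((cur ((hh (1, 0) (0, 1)).differentiableOn (by norm_num)) h0').const_mul b)).const_mul a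
    |>.add ((((cur ((hh (0, 1) (1, 0)).differentiableOn (by norm_num)) h0').const_mul a).add
      ((cur ((hh (0, 1) (0, 1)).differentiableOn (by norm_num)) h0').const_mul b)).const_mul b))
    (α := c * a + c * b) (β := k₁ * a ^ 2 + k₂ * b ^ 2) (γ := h₁ * a ^ 3 + h₂ * b ^ 3)
    (((ht.comp_tendsto htend).trans_isBigO hbig).congr_left fun t => by
      simp only [Function.comp]; ring)
  simpa only [zero_mul] using key

/-- The partial derivatives up to order three at the origin, read off from the Taylor expansion.
The third derivatives appear through the derivative of the Hessian along `(1, 1)`. -/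
theorem partials_of_taylor {f : ℝ × ℝ → ℝ} {Ω : Set (ℝ × ℝ)} (hΩ : IsOpen Ω)
    (h0 : ((0 : ℝ), (0 : ℝ)) ∈ Ω) (hf : ContDiffOn ℝ 3 f Ω) {c k₁ k₂ h₁ h₂ : ℝ}
    (ht : (fun p : ℝ × ℝ => f p - (c * p.1 + c * p.2 + k₁ * p.1 ^ 2 + k₂ * p.2 ^ 2 +
          h₁ * p.1 ^ 3 + h₂ * p.2 ^ 3)) =o[𝓝 ((0 : ℝ), (0 : ℝ))]
        fun p : ℝ × ℝ => (p.1 ^ 2 + p.2 ^ 2) ^ ((3 : ℝ) / 2)) :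
    dirFDeriv (1, 0) f (0, 0) = c ∧ dirFDeriv (0, 1) f (0, 0) = c ∧
    dirFDeriv (1, 0) (dirFDeriv (1, 0) f) (0, 0) = 2 * k₁ ∧
    dirFDeriv (0, 1) (dirFDeriv (1, 0) f) (0, 0) = 0 ∧
    dirFDeriv (1, 0) (dirFDeriv (0, 1) f) (0, 0) = 0 ∧
    dirFDeriv (0, 1) (dirFDeriv (0, 1) f) (0, 0) = 2 * k₂ ∧
    dirFDeriv (1, 0) (dirFDeriv (1, 0) (dirFDeriv (1, 0) f)) (0, 0) +
      dirFDeriv (0, 1) (dirFDeriv (1, 0) (dirFDeriv (1, 0) f)) (0, 0) = 6 * h₁ ∧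
    dirFDeriv (1, 0) (dirFDeriv (0, 1) (dirFDeriv (1, 0) f)) (0, 0) +
      dirFDeriv (0, 1) (dirFDeriv (0, 1) (dirFDeriv (1, 0) f)) (0, 0) = 0 ∧
    dirFDeriv (1, 0) (dirFDeriv (1, 0) (dirFDeriv (0, 1) f)) (0, 0) +
      dirFDeriv (0, 1) (dirFDeriv (1, 0) (dirFDeriv (0, 1) f)) (0, 0) = 0 ∧
    dirFDeriv (1, 0) (dirFDeriv (0, 1) (dirFDeriv (0, 1) f)) (0, 0) +
      dirFDeriv (0, 1) (dirFDeriv (0, 1) (dirFDeriv (0, 1) f)) (0, 0) = 6 * h₂ := by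
  have hg : ∀ v, ContDiffOn ℝ 2 (dirFDeriv v f) Ω := hf.dirFDeriv hΩ (by norm_num)
  have hat : ∀ v w x, dirFDeriv v (dirFDeriv w (dirFDeriv x f)) (0, 0) =
      dirFDeriv w (dirFDeriv v (dirFDeriv x f)) (0, 0) := fun v w x =>
    ((hg x).contDiffAt (hΩ.mem_nhds h0)).dirFDeriv_comm v w
  have hcomm : dirFDeriv (0, 1) (dirFDeriv (1, 0) f)
      =ᶠ[𝓝 ((0 : ℝ), (0 : ℝ))] dirFDeriv (1, 0) (dirFDeriv (0, 1) f) := by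
    filter_upwards [hΩ.mem_nhds h0] with p hp
    exact ((hf.contDiffAt (hΩ.mem_nhds hp)).of_le (by norm_num)).dirFDeriv_comm _ _
  obtain ⟨a1, a2, a3⟩ := line_derivs_of_taylor hΩ h0 hf ht 1 0
  obtain ⟨b1, b2, b3⟩ := line_derivs_of_taylor hΩ h0 hf ht 0 1
  obtain ⟨-, c2, c3⟩ := line_derivs_of_taylor hΩ h0 hf ht 1 1
  obtain ⟨-, -, d3⟩ := line_derivs_of_taylor hΩ h0 hf ht 1 (-1)
  have e0 := hcomm.eq_of_nhds
  have e1 := hcomm.dirFDeriv_eq (1, 0)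
  have e2 := hcomm.dirFDeriv_eq (0, 1)
  have e3 := hat (1, 0) (0, 1) (1, 0)
  have e4 := hat (1, 0) (0, 1) (0, 1)
  refine ⟨?_, ?_, ?_, ?_, ?_, ?_, ?_, ?_, ?_, ?_⟩ <;> linarith

/-- The diffusivity `φ'(√w)/√w` as a function of the squared gradient norm `w`. -/
noncomputable def diffusivity (φ : ℝ → ℝ) (w : ℝ) : ℝ := deriv φ (√w) / √w

/-- The derivative of `diffusivity φ` on `(0, ∞)`. -/
noncomputable def diffusivityDeriv (φ : ℝ → ℝ) (w : ℝ) : ℝ :=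
  (deriv (deriv φ) (√w) * √w - deriv φ (√w)) / (√w) ^ 2 * (1 / (2 * √w))

theorem hasDerivAt_diffusivity {φ : ℝ → ℝ} (hφ : ContDiff ℝ (⊤ : ℕ∞) φ) {w : ℝ} (hw : 0 < w) :
    HasDerivAt (diffusivity φ) (diffusivityDeriv φ w) w := by
  have hs := Real.hasDerivAt_sqrt hw.ne'
  have h1 : HasDerivAt (fun s => deriv φ s / s)
      ((deriv (deriv φ) (√w) * √w - deriv φ (√w) * 1) / (√w) ^ 2) (√w) :=
    (((hφ.iterate_deriv 1).differentiable (by simp)) (√w)).hasDerivAt.div (hasDerivAt_id _)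
      (Real.sqrt_pos.2 hw).ne'
  have := h1.comp w hs
  rw [mul_one] at this
  exact this

theorem hasDerivAt_diffusivityDeriv_one {φ : ℝ → ℝ} (hφ : ContDiff ℝ (⊤ : ℕ∞) φ)
    (h2 : deriv (deriv φ) 1 = 0) :
    HasDerivAt (diffusivityDeriv φ) ((deriv (deriv (deriv φ)) 1 + 3 * deriv φ 1) / 4) 1 := by
  have d1 := (((hφ.iterate_deriv 1).differentiable (by simp)) 1).hasDerivAt
  have d2 := (((hφ.iterate_deriv 2).differentiable (by simp)) 1).hasDerivAt
  simp only [Function.iterate_succ, Function.iterate_zero, Function.comp, id] at d1 d2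
  have hs : HasDerivAt Real.sqrt (1 / 2) 1 := by
    simpa using Real.hasDerivAt_sqrt one_ne_zero
  have h1 : HasDerivAt (fun s : ℝ => (deriv (deriv φ) s * s - deriv φ s) / s ^ 2 * (1 / (2 * s)))
      ((deriv (deriv (deriv φ)) 1 + 3 * deriv φ 1) / 2) 1 := by
    refine ((((d2.mul (hasDerivAt_id 1)).sub d1).div (hasDerivAt_pow 2 (1 : ℝ)) (by simp)).mul
      ((hasDerivAt_const (1 : ℝ) (1 : ℝ)).div ((hasDerivAt_id (1 : ℝ)).const_mul 2)
        (by simp))).congr_deriv ?_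
    simp [h2]
    ring
  exact (h1.comp_of_eq 1 hs Real.sqrt_one.symm).congr_deriv (by ring)

theorem diffusivity_one (φ : ℝ → ℝ) : diffusivity φ 1 = deriv φ 1 := by simp [diffusivity]

theorem diffusivityDeriv_one {φ : ℝ → ℝ} (h2 : deriv (deriv φ) 1 = 0) :
    diffusivityDeriv φ 1 = -deriv φ 1 / 2 := by
  simp [diffusivityDeriv, h2]; ring

/-- The right-hand side `div(φ'(|∇f|)∇f/|∇f|)` of the equation, expanded in partial derivatives
of `f`. -/
noncomputable def pmRhs (φ : ℝ → ℝ) (f : ℝ × ℝ → ℝ) (p : ℝ × ℝ) : ℝ :=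
  diffusivityDeriv φ (dirFDeriv (1, 0) f p ^ 2 + dirFDeriv (0, 1) f p ^ 2) *
      (2 * dirFDeriv (1, 0) f p * dirFDeriv (1, 0) (dirFDeriv (1, 0) f) p +
        2 * dirFDeriv (0, 1) f p * dirFDeriv (1, 0) (dirFDeriv (0, 1) f) p) *
      dirFDeriv (1, 0) f p +
    diffusivity φ (dirFDeriv (1, 0) f p ^ 2 + dirFDeriv (0, 1) f p ^ 2) *
      dirFDeriv (1, 0) (dirFDeriv (1, 0) f) p +
  (diffusivityDeriv φ (dirFDeriv (1, 0) f p ^ 2 + dirFDeriv (0, 1) f p ^ 2) *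
      (2 * dirFDeriv (1, 0) f p * dirFDeriv (0, 1) (dirFDeriv (1, 0) f) p +
        2 * dirFDeriv (0, 1) f p * dirFDeriv (0, 1) (dirFDeriv (0, 1) f) p) *
      dirFDeriv (0, 1) f p +
    diffusivity φ (dirFDeriv (1, 0) f p ^ 2 + dirFDeriv (0, 1) f p ^ 2) *
      dirFDeriv (0, 1) (dirFDeriv (0, 1) f) p)

theorem DifferentiableAt.hasDerivAt_fst {f : ℝ × ℝ → ℝ} {x y : ℝ}
    (hf : DifferentiableAt ℝ f (x, y)) :
    HasDerivAt (fun s => f (s, y)) (dirFDeriv (1, 0) f (x, y)) x := by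
  simpa using hf.hasDerivAt_curve (x := id) (y := fun _ => y) (t := x) (hasDerivAt_id x)
    (hasDerivAt_const x y)

theorem DifferentiableAt.hasDerivAt_snd {f : ℝ × ℝ → ℝ} {x y : ℝ}
    (hf : DifferentiableAt ℝ f (x, y)) :
    HasDerivAt (fun s => f (x, s)) (dirFDeriv (0, 1) f (x, y)) y := by
  simpa using hf.hasDerivAt_curve (x := fun _ => x) (y := id) (t := y) (hasDerivAt_const y x)
    (hasDerivAt_id y)

/-- At time `0` the divergence of the flux is given by the expanded right-hand side. -/
theorem deriv_pmFlux_add_eq_pmRhs {φ : ℝ → ℝ} (hφ : ContDiff ℝ (⊤ : ℕ∞) φ)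
    {u : ℝ → ℝ → ℝ → ℝ} {f : ℝ × ℝ → ℝ} {Ω : Set (ℝ × ℝ)} (hΩ : IsOpen Ω)
    (hf : ContDiffOn ℝ 3 f Ω) (hu : ∀ x y : ℝ, (x, y) ∈ Ω → u x y 0 = f (x, y))
    {x y : ℝ} (hxy : (x, y) ∈ Ω)
    (hpos : 0 < dirFDeriv (1, 0) f (x, y) ^ 2 + dirFDeriv (0, 1) f (x, y) ^ 2) :
    deriv (fun s => pmFlux1 φ u s y 0) x + deriv (fun s => pmFlux2 φ u x s 0) y =
      pmRhs φ f (x, y) := by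
  have hslice1 : ∀ {x y : ℝ}, (x, y) ∈ Ω → ∀ᶠ s in 𝓝 x, (s, y) ∈ Ω := fun {x y} h =>
    (Continuous.prodMk_left y).continuousAt.eventually (hΩ.mem_nhds h)
  have hslice2 : ∀ {x y : ℝ}, (x, y) ∈ Ω → ∀ᶠ s in 𝓝 y, (x, s) ∈ Ω := fun {x y} h =>
    (Continuous.prodMk_right x).continuousAt.eventually (hΩ.mem_nhds h)
  have hd1 : ∀ {x y : ℝ}, (x, y) ∈ Ω → deriv (fun s => u s y 0) x = dirFDeriv (1, 0) f (x, y) := by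
    intro x y h
    have he : (fun s => u s y 0) =ᶠ[𝓝 x] fun s => f (s, y) :=
      (hslice1 h).mono fun s hs => hu s y hs
    rw [he.deriv_eq]
    exact ((hf.differentiableOn (by norm_num)).differentiableAt
      (hΩ.mem_nhds h)).hasDerivAt_fst.deriv
  have hd2 : ∀ {x y : ℝ}, (x, y) ∈ Ω → deriv (fun s => u x s 0) y = dirFDeriv (0, 1) f (x, y) := by
    intro x y h
    have he : (fun s => u x s 0) =ᶠ[𝓝 y] fun s => f (x, s) :=
      (hslice2 h).mono fun s hs => hu x s hs
    rw [he.deriv_eq]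
    exact ((hf.differentiableOn (by norm_num)).differentiableAt
      (hΩ.mem_nhds h)).hasDerivAt_snd.deriv
  have hdiff : ∀ v, DifferentiableAt ℝ (dirFDeriv v f) (x, y) := fun v =>
    ((hf.dirFDeriv (m := 2) hΩ (by norm_num) v).differentiableOn (by norm_num)).differentiableAt
      (hΩ.mem_nhds hxy)
  have e1 : (fun s => pmFlux1 φ u s y 0) =ᶠ[𝓝 x] fun s =>
      diffusivity φ (dirFDeriv (1, 0) f (s, y) ^ 2 + dirFDeriv (0, 1) f (s, y) ^ 2) *
        dirFDeriv (1, 0) f (s, y) := by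
    filter_upwards [hslice1 hxy] with s hs
    simp only [pmFlux1, gradSqT, diffusivity, hd1 hs, hd2 hs]
    ring
  have e2 : (fun s => pmFlux2 φ u x s 0) =ᶠ[𝓝 y] fun s =>
      diffusivity φ (dirFDeriv (1, 0) f (x, s) ^ 2 + dirFDeriv (0, 1) f (x, s) ^ 2) *
        dirFDeriv (0, 1) f (x, s) := by
    filter_upwards [hslice2 hxy] with s hs
    simp only [pmFlux2, gradSqT, diffusivity, hd1 hs, hd2 hs]
    ring
  have w1 := ((hdiff (1, 0)).hasDerivAt_fst.pow 2).add ((hdiff (0, 1)).hasDerivAt_fst.pow 2)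
  have w2 := ((hdiff (1, 0)).hasDerivAt_snd.pow 2).add ((hdiff (0, 1)).hasDerivAt_snd.pow 2)
  have g1 := ((hasDerivAt_diffusivity hφ hpos).comp x w1).mul (hdiff (1, 0)).hasDerivAt_fst
  have g2 := ((hasDerivAt_diffusivity hφ hpos).comp y w2).mul (hdiff (0, 1)).hasDerivAt_snd
  rw [e1.deriv_eq, e2.deriv_eq]
  refine (congrArg₂ (· + ·) g1.deriv g2.deriv).trans ?_
  simp [pmRhs]

/-- Derivative of the right-hand side of the equation along the diagonal. -/
theorem hasDerivAt_pmRhs_diag {φ : ℝ → ℝ} (hφ : ContDiff ℝ (⊤ : ℕ∞) φ)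
    (h2 : deriv (deriv φ) 1 = 0) {f : ℝ × ℝ → ℝ} {Ω : Set (ℝ × ℝ)} (hΩ : IsOpen Ω)
    (h0 : ((0 : ℝ), (0 : ℝ)) ∈ Ω) (hf : ContDiffOn ℝ 3 f Ω) {c k₁ k₂ h₁ h₂ : ℝ}
    (hc : c ^ 2 = 1 / 2)
    (ht : (fun p : ℝ × ℝ => f p - (c * p.1 + c * p.2 + k₁ * p.1 ^ 2 + k₂ * p.2 ^ 2 +
          h₁ * p.1 ^ 3 + h₂ * p.2 ^ 3)) =o[𝓝 ((0 : ℝ), (0 : ℝ))]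
        fun p : ℝ × ℝ => (p.1 ^ 2 + p.2 ^ 2) ^ ((3 : ℝ) / 2)) :
    HasDerivAt (fun s => pmRhs φ f (s, s))
      (deriv φ 1 * (6 * (h₁ + h₂) / 2 + c * (4 * k₁ * k₂ - 6 * k₁ ^ 2 - 6 * k₂ ^ 2)) +
        2 * c * deriv (deriv (deriv φ)) 1 * (k₁ + k₂) ^ 2) 0 := by
  obtain ⟨p1, p2, p3, p4, p5, p6, p7, p8, p9, p10⟩ := partials_of_taylor hΩ h0 hf ht
  have hg : ∀ v, ContDiffOn ℝ 2 (dirFDeriv v f) Ω := hf.dirFDeriv hΩ (by norm_num)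
  have hh : ∀ v w, ContDiffOn ℝ 1 (dirFDeriv w (dirFDeriv v f)) Ω := fun v =>
    (hg v).dirFDeriv hΩ (by norm_num)
  have diag : ∀ {g : ℝ × ℝ → ℝ}, DifferentiableOn ℝ g Ω → HasDerivAt (fun s => g (s, s))
      (dirFDeriv (1, 0) g (0, 0) + dirFDeriv (0, 1) g (0, 0)) 0 := fun hg => by
    simpa using (hg.differentiableAt (hΩ.mem_nhds h0)).hasDerivAt_curve (x := id) (y := id)
      (t := (0 : ℝ)) (hasDerivAt_id _) (hasDerivAt_id _)
  have dP := diag ((hg (1, 0)).differentiableOn (by norm_num))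
  have dQ := diag ((hg (0, 1)).differentiableOn (by norm_num))
  have dA := diag ((hh (1, 0) (1, 0)).differentiableOn (by norm_num))
  have dB := diag ((hh (0, 1) (1, 0)).differentiableOn (by norm_num))
  have dB' := diag ((hh (1, 0) (0, 1)).differentiableOn (by norm_num))
  have dC := diag ((hh (0, 1) (0, 1)).differentiableOn (by norm_num))
  rw [p3, p4] at dP
  rw [p5, p6] at dQ
  rw [p7] at dA
  rw [p9] at dB
  rw [p8] at dB'
  rw [p10] at dC
  have dW := (dP.pow 2).add (dQ.pow 2)
  have hW : dirFDeriv (1, 0) f (0, 0) ^ 2 + dirFDeriv (0, 1) f (0, 0) ^ 2 = 1 := by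
    rw [p1, p2, hc]; norm_num
  have dG := (hasDerivAt_diffusivity hφ one_pos).comp_of_eq 0 dW hW.symm
  have dG' := (hasDerivAt_diffusivityDeriv_one hφ h2).comp_of_eq 0 dW hW.symm
  have main := (((dG'.mul (((dP.const_mul 2).mul dA).add ((dQ.const_mul 2).mul dB))).mul dP).add
    (dG.mul dA)).add
    (((dG'.mul (((dP.const_mul 2).mul dB').add ((dQ.const_mul 2).mul dC))).mul dQ).add
    (dG.mul dC))
  refine main.congr_deriv ?_
  simp only [Function.comp, Pi.add_apply, Pi.mul_apply, Pi.pow_apply, hW, diffusivity_one,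
    diffusivityDeriv_one h2]
  simp only [p1, p2, p3, p4, p5, p6]
  have hc3 : c ^ 3 = c / 2 := by rw [pow_succ, hc]; ring
  norm_num
  ring_nf
  simp only [hc, hc3]
  ring

/-- For a `C²` function on `Ω × [0,T)`, the time derivative of the spatial gradient at
the origin and initial time exists, and the time derivative along the diagonal at time `0` is
differentiable with derivative the sum of its two components. -/
theorem exists_time_deriv_grad {u : ℝ → ℝ → ℝ → ℝ} {Ω : Set (ℝ × ℝ)} (hΩ : IsOpen Ω)
    (h0 : ((0 : ℝ), (0 : ℝ)) ∈ Ω) {T : ℝ} (hT : 0 < T)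
    (hu : ContDiffOn ℝ 2 (fun p : ℝ × ℝ × ℝ => u p.1 p.2.1 p.2.2)
      {p : ℝ × ℝ × ℝ | (p.1, p.2.1) ∈ Ω ∧ p.2.2 ∈ Set.Ico 0 T}) :
    ∃ α β : ℝ,
      HasDerivWithinAt (fun t => deriv (fun s => u s 0 t) 0) α (Set.Ico 0 T) 0 ∧
      HasDerivWithinAt (fun t => deriv (fun s => u 0 s t) 0) β (Set.Ico 0 T) 0 ∧
      HasDerivAt (fun s => derivWithin (fun t => u s s t) (Set.Ico 0 T) 0) (α + β) 0 := by
  obtain ⟨ε, hε, hball⟩ := Metric.isOpen_iff.1 hΩ _ h0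
  set I : Set ℝ := Metric.ball 0 ε with hI
  have hI0 : (0 : ℝ) ∈ I := Metric.mem_ball_self hε
  have hIo : IsOpen I := Metric.isOpen_ball
  set S : Set (ℝ × ℝ × ℝ) := I ×ˢ I ×ˢ Set.Ico 0 T with hS
  set U : ℝ × ℝ × ℝ → ℝ := fun p => u p.1 p.2.1 p.2.2 with hU
  have hUS : ContDiffOn ℝ 2 U S := hu.mono fun p hp =>
    ⟨hball (by rw [← ball_prod_same]; exact ⟨hp.1, hp.2.1⟩), hp.2.2⟩
  have hconv : Convex ℝ S := (convex_ball _ _).prod ((convex_ball _ _).prod (convex_Ico _ _))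
  have hint : (interior S).Nonempty := by
    simp only [hS, interior_prod_eq, hIo.interior_eq, interior_Ico]
    exact ⟨(0, 0, T / 2), hI0, hI0, by constructor <;> simp <;> linarith⟩
  have hSu : UniqueDiffOn ℝ S := uniqueDiffOn_convex hconv hint
  have hz : ((0 : ℝ), (0 : ℝ), (0 : ℝ)) ∈ S := ⟨hI0, hI0, le_rfl, hT⟩
  have hzc : ((0 : ℝ), (0 : ℝ), (0 : ℝ)) ∈ closure (interior S) := by
    rw [hconv.closure_interior_eq_closure_of_nonempty_interior hint]
    exact subset_closure hz
  have hmem : ∀ {x y t : ℝ}, x ∈ I → y ∈ I → t ∈ Set.Ico 0 T → (x, y, t) ∈ S :=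
    fun hx hy ht => ⟨hx, hy, ht⟩
  have hsym := (hUS _ hz).isSymmSndFDerivWithinAt (by simp) hSu hzc hz
  set L := fderivWithin ℝ U S with hL
  have hUd : ∀ p ∈ S, HasFDerivWithinAt U (L p) S p := fun p hp =>
    (hUS.differentiableOn (by norm_num) p hp).hasFDerivWithinAt
  have hLd : HasFDerivWithinAt L (fderivWithin ℝ L S (0, 0, 0)) S (0, 0, 0) :=
    ((hUS.fderivWithin hSu (m := 1) (by norm_num)).differentiableOn (by norm_num) _
      hz).hasFDerivWithinAt
  have hLv : ∀ v, HasFDerivWithinAt (fun p => L p v)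
      ((fderivWithin ℝ L S (0, 0, 0)).flip v) S (0, 0, 0) := fun v => by
    refine (hLd.clm_apply (hasFDerivWithinAt_const v _ _)).congr_fderiv ?_
    ext <;> simp
  have hdx : ∀ t ∈ Set.Ico 0 T, deriv (fun s => u s 0 t) 0 = L (0, 0, t) (1, 0, 0) := by
    intro t ht
    have hcurve : HasDerivWithinAt (fun s : ℝ => (s, (0 : ℝ), t)) (1, 0, 0) I 0 :=
      ((hasDerivAt_id (0 : ℝ)).prodMk
        ((hasDerivAt_const _ _).prodMk (hasDerivAt_const _ _))).hasDerivWithinAt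
    exact (((hUd (0, 0, t) ⟨hI0, hI0, ht⟩).comp_hasDerivWithinAt (0 : ℝ) hcurve
      fun s hs => hmem hs hI0 ht).hasDerivAt (hIo.mem_nhds hI0)).deriv
  have hdy : ∀ t ∈ Set.Ico 0 T, deriv (fun s => u 0 s t) 0 = L (0, 0, t) (0, 1, 0) := by
    intro t ht
    have hcurve : HasDerivWithinAt (fun s : ℝ => ((0 : ℝ), s, t)) (0, 1, 0) I 0 :=
      ((hasDerivAt_const _ _).prodMk
        ((hasDerivAt_id (0 : ℝ)).prodMk (hasDerivAt_const _ _))).hasDerivWithinAt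
    exact (((hUd (0, 0, t) ⟨hI0, hI0, ht⟩).comp_hasDerivWithinAt (0 : ℝ) hcurve
      fun s hs => hmem hI0 hs ht).hasDerivAt (hIo.mem_nhds hI0)).deriv
  have htime : ∀ s : ℝ, HasDerivWithinAt (fun t : ℝ => (s, s, t)) (0, 0, 1) (Set.Ico 0 T) 0 :=
    fun s => ((hasDerivAt_const _ _).prodMk
      ((hasDerivAt_const _ _).prodMk (hasDerivAt_id (0 : ℝ)))).hasDerivWithinAt
  have hdt : ∀ s ∈ I, derivWithin (fun t => u s s t) (Set.Ico 0 T) 0 = L (s, s, 0) (0, 0, 1) := by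
    intro s hs
    exact ((hUd (s, s, 0) ⟨hs, hs, le_rfl, hT⟩).comp_hasDerivWithinAt (0 : ℝ) (htime s)
      fun t ht => hmem hs hs ht).derivWithin (uniqueDiffOn_Ico 0 T 0 ⟨le_rfl, hT⟩)
  have hgrad : ∀ v, HasDerivWithinAt (fun t => L (0, 0, t) v)
      (fderivWithin ℝ L S (0, 0, 0) (0, 0, 1) v) (Set.Ico 0 T) 0 := fun v => by
    have := (hLv v).comp_hasDerivWithinAt (0 : ℝ) (htime 0) fun t ht => hmem hI0 hI0 ht
    exact this
  refine ⟨fderivWithin ℝ L S (0, 0, 0) (0, 0, 1) (1, 0, 0),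
    fderivWithin ℝ L S (0, 0, 0) (0, 0, 1) (0, 1, 0),
    (hgrad _).congr hdx (hdx 0 ⟨le_rfl, hT⟩), (hgrad _).congr hdy (hdy 0 ⟨le_rfl, hT⟩), ?_⟩
  have hcurve : HasDerivWithinAt (fun s : ℝ => (s, s, (0 : ℝ))) (1, 1, 0) I 0 :=
    ((hasDerivAt_id (0 : ℝ)).prodMk
      ((hasDerivAt_id (0 : ℝ)).prodMk (hasDerivAt_const _ _))).hasDerivWithinAt
  have hdiag := (hLv (0, 0, 1)).comp_hasDerivWithinAt (0 : ℝ) hcurve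
    fun s hs => hmem hs hs ⟨le_rfl, hT⟩
  refine ((hdiag.congr hdt (hdt 0 hI0)).hasDerivAt (hIo.mem_nhds hI0)).congr_deriv ?_
  have hv : ((1 : ℝ), (1 : ℝ), (0 : ℝ)) = (1, 0, 0) + (0, 1, 0) := by simp
  rw [ContinuousLinearMap.flip_apply, hsym.eq, hv, map_add]

/-- For a `C²` solution of the generalized Perona–Malik equation
`u_t = div(φ'(|∇u|)·∇u/|∇u|)` with initial datum `u₀` having the given third-order
Taylor expansion at the origin, the time derivative of `|∇u|²` at `(0,0,0)` exists
and equals `φ'(1)(3√2(h₁+h₂) + 4k₁k₂ - 6k₁² - 6k₂²) + 2φ'''(1)(k₁+k₂)²`. -/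
theorem deriv_gradSq_at_origin
    (φ : ℝ → ℝ) (hφ : ContDiff ℝ (⊤ : ℕ∞) φ) (hφ2one : deriv (deriv φ) 1 = 0)
    (k₁ k₂ h₁ h₂ : ℝ)
    (Ω : Set (ℝ × ℝ)) (hΩ : IsOpen Ω) (hΩ0 : ((0 : ℝ), (0 : ℝ)) ∈ Ω)
    (T : ℝ) (hT : 0 < T)
    (u : ℝ → ℝ → ℝ → ℝ) (u₀ : ℝ → ℝ → ℝ)
    -- `u ∈ C²(Ω×[0,T))`
    (huC2 : ContDiffOn ℝ 2 (fun p : ℝ × ℝ × ℝ => u p.1 p.2.1 p.2.2)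
      {p : ℝ × ℝ × ℝ | (p.1, p.2.1) ∈ Ω ∧ p.2.2 ∈ Set.Ico 0 T})
    -- the equation holds at every point where `∇u ≠ 0`
    (heq : ∀ x y t : ℝ, (x, y) ∈ Ω → t ∈ Set.Ico 0 T →
      (deriv (fun s => u s y t) x ≠ 0 ∨ deriv (fun s => u x s t) y ≠ 0) →
      HasDerivWithinAt (fun s => u x y s)
        (deriv (fun s => pmFlux1 φ u s y t) x + deriv (fun s => pmFlux2 φ u x s t) y)
        (Set.Ico 0 T) t)
    -- `u₀` is of class `C³` on `Ω` ...
    (hu₀C3 : ContDiffOn ℝ 3 (fun p : ℝ × ℝ => u₀ p.1 p.2) Ω)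
    -- ... with the given third-order Taylor expansion at the origin
    (htaylor : (fun p : ℝ × ℝ => u₀ p.1 p.2 -
        (Real.sqrt 2 / 2 * p.1 + Real.sqrt 2 / 2 * p.2 + k₁ * p.1 ^ 2 + k₂ * p.2 ^ 2 +
          h₁ * p.1 ^ 3 + h₂ * p.2 ^ 3)) =o[nhds ((0 : ℝ), (0 : ℝ))]
        fun p : ℝ × ℝ => (p.1 ^ 2 + p.2 ^ 2) ^ ((3 : ℝ) / 2))
    -- initial condition
    (hinit : ∀ x y : ℝ, (x, y) ∈ Ω → u x y 0 = u₀ x y) :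
    HasDerivWithinAt (fun s => gradSqT u 0 0 s)
      (deriv φ 1 * (3 * Real.sqrt 2 * (h₁ + h₂) + 4 * k₁ * k₂ - 6 * k₁ ^ 2 - 6 * k₂ ^ 2) +
        2 * deriv (deriv (deriv φ)) 1 * (k₁ + k₂) ^ 2)
      (Set.Ico 0 T) 0 := by
  obtain ⟨α, β, hα, hβ, hdiag⟩ := exists_time_deriv_grad hΩ hΩ0 hT huC2
  obtain ⟨p1, p2, -⟩ := partials_of_taylor hΩ hΩ0 hu₀C3 htaylor
  have hsq : √(2 : ℝ) ^ 2 = 2 := Real.sq_sqrt (by norm_num)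
  have hc : (√(2 : ℝ) / 2) ^ 2 = 1 / 2 := by rw [div_pow, hsq]; norm_num
  set f : ℝ × ℝ → ℝ := fun p => u₀ p.1 p.2 with hf_def
  have hdf : ∀ {x y : ℝ}, (x, y) ∈ Ω → DifferentiableAt ℝ f (x, y) := fun h =>
    (hu₀C3.differentiableOn (by norm_num)).differentiableAt (hΩ.mem_nhds h)
  have hdx : ∀ {x y : ℝ}, (x, y) ∈ Ω →
      deriv (fun s => u s y 0) x = dirFDeriv (1, 0) f (x, y) := fun {x y} h => by
    refine ((hdf h).hasDerivAt_fst.congr_of_eventuallyEq ?_).deriv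
    exact ((Continuous.prodMk_left y).continuousAt.eventually (hΩ.mem_nhds h)).mono
      fun s hs => hinit s y hs
  have hdy : ∀ {x y : ℝ}, (x, y) ∈ Ω →
      deriv (fun s => u x s 0) y = dirFDeriv (0, 1) f (x, y) := fun {x y} h => by
    refine ((hdf h).hasDerivAt_snd.congr_of_eventuallyEq ?_).deriv
    exact ((Continuous.prodMk_right x).continuousAt.eventually (hΩ.mem_nhds h)).mono
      fun s hs => hinit x s hs
  have hcont : ∀ v, ContinuousAt (dirFDeriv v f) (0, 0) := fun v =>
    (hu₀C3.dirFDeriv (m := 2) hΩ (by norm_num) v).continuousOn.continuousAt (hΩ.mem_nhds hΩ0)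
  have hpos : ∀ᶠ p in 𝓝 ((0 : ℝ), (0 : ℝ)),
      0 < dirFDeriv (1, 0) f p ^ 2 + dirFDeriv (0, 1) f p ^ 2 := by
    refine (((hcont (1, 0)).pow 2).add ((hcont (0, 1)).pow 2)).eventually_const_lt ?_
    simp only [Pi.add_apply, Pi.pow_apply, p1, p2, hc]
    norm_num
  have hdiagcont : Tendsto (fun s : ℝ => (s, s)) (𝓝 0) (𝓝 ((0 : ℝ), (0 : ℝ))) :=
    tendsto_id.prodMk_nhds tendsto_id
  have hpde : (fun s => derivWithin (fun t => u s s t) (Set.Ico 0 T) 0)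
      =ᶠ[𝓝 0] fun s => pmRhs φ f (s, s) := by
    filter_upwards [hdiagcont.eventually hpos, hdiagcont.eventually (hΩ.mem_nhds hΩ0)]
      with s hs hsΩ
    have hne : deriv (fun r => u r s 0) s ≠ 0 ∨ deriv (fun r => u s r 0) s ≠ 0 := by
      rw [hdx hsΩ, hdy hsΩ]
      by_contra! h
      simp [h.1, h.2] at hs
    rw [(heq s s 0 hsΩ ⟨le_rfl, hT⟩ hne).derivWithin (uniqueDiffOn_Ico 0 T 0 ⟨le_rfl, hT⟩)]
    exact deriv_pmFlux_add_eq_pmRhs hφ hΩ hu₀C3 hinit hsΩ hs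
  have hsum := hdiag.unique
    ((hasDerivAt_pmRhs_diag hφ hφ2one hΩ hΩ0 hu₀C3 hc htaylor).congr_of_eventuallyEq hpde)
  refine ((hα.pow 2).add (hβ.pow 2)).congr_deriv ?_
  simp only [hdx hΩ0, hdy hΩ0, p1, p2]
  norm_num
  rw [← mul_add, hsum]
  linear_combination
    (deriv φ 1 * (4 * k₁ * k₂ - 6 * k₁ ^ 2 - 6 * k₂ ^ 2) / 2 +
      deriv (deriv (deriv φ)) 1 * (k₁ + k₂) ^ 2) * hsq
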